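/- Let T be a finite-dimensional real vector space, F ⊆ T a subspace, and L ⊆ T × T* a maximal isotropic subspace for the canonical symmetric form. Define the codistribution K* := { θ ∈ T* : there exists Y ∈ F with (Y, θ) ∈ L }. Then T = H(L, F) ⊕ F (i.e. L is F-coupling) if and only if T* = ann F ⊕ K*. -/

import Mathlib

/-- The canonical symmetric pairing `g((X,α),(Y,β)) = (1/2)(β(X) + α(Y))` on `T × T*`. -/
noncomputable def cpair {T : Type*} [AddCommGroup T] [Module ℝ T]
    (p q : T × Module.Dual ℝ T) : ℝ :=
  (1/2 : ℝ) * (q.2 p.1 + p.2 q.1)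

/-- A subspace of `T × T*` is isotropic if the canonical pairing vanishes on it. -/
def IsIsotropic {T : Type*} [AddCommGroup T] [Module ℝ T]
    (L : Submodule ℝ (T × Module.Dual ℝ T)) : Prop :=
  ∀ p ∈ L, ∀ q ∈ L, cpair p q = 0

/-- `H(L, F) = {Z : ∃ α ∈ ann F, (Z, α) ∈ L}`. -/
def couplingH {T : Type*} [AddCommGroup T] [Module ℝ T]
    (L : Submodule ℝ (T × Module.Dual ℝ T)) (F : Submodule ℝ T) : Submodule ℝ T :=
  Submodule.map (LinearMap.fst ℝ T (Module.Dual ℝ T))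
    (L ⊓ Submodule.prod ⊤ F.dualAnnihilator)

/-- The codistribution `K* = {θ : ∃ Y ∈ F, (Y, θ) ∈ L}`. -/
def couplingK {T : Type*} [AddCommGroup T] [Module ℝ T]
    (L : Submodule ℝ (T × Module.Dual ℝ T)) (F : Submodule ℝ T) :
    Submodule ℝ (Module.Dual ℝ T) :=
  Submodule.map (LinearMap.snd ℝ T (Module.Dual ℝ T))
    (L ⊓ Submodule.prod F ⊤)

/-- Membership in `couplingH`. -/
theorem mem_couplingH {T : Type*} [AddCommGroup T] [Module ℝ T]
    {L : Submodule ℝ (T × Module.Dual ℝ T)} {F : Submodule ℝ T} {Z : T} :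
    Z ∈ couplingH L F ↔ ∃ α ∈ F.dualAnnihilator, (Z, α) ∈ L := by
  simp [couplingH, and_comm]

/-- Membership in `couplingK`. -/
theorem mem_couplingK {T : Type*} [AddCommGroup T] [Module ℝ T]
    {L : Submodule ℝ (T × Module.Dual ℝ T)} {F : Submodule ℝ T} {θ : Module.Dual ℝ T} :
    θ ∈ couplingK L F ↔ ∃ Y ∈ F, (Y, θ) ∈ L := by
  simp [couplingK, and_comm]

theorem cpair_eq_zero_iff {T : Type*} [AddCommGroup T] [Module ℝ T]
    {p q : T × Module.Dual ℝ T} : cpair p q = 0 ↔ q.2 p.1 + p.2 q.1 = 0 := by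
  simp [cpair]

/-- A null vector orthogonal to a maximal isotropic subspace lies in it. -/
theorem mem_of_orthogonal_of_null {T : Type*} [AddCommGroup T] [Module ℝ T]
    {L : Submodule ℝ (T × Module.Dual ℝ T)} (hiso : IsIsotropic L)
    (hmax : ∀ L' : Submodule ℝ (T × Module.Dual ℝ T), IsIsotropic L' → L ≤ L' → L' = L)
    {p : T × Module.Dual ℝ T} (hnull : p.2 p.1 = 0)
    (horth : ∀ q ∈ L, q.2 p.1 + p.2 q.1 = 0) : p ∈ L := by
  rw [← hmax (L ⊔ Submodule.span ℝ {p}) ?_ le_sup_left]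
  · exact Submodule.mem_sup_right (Submodule.mem_span_singleton_self p)
  · intro u hu v hv
    obtain ⟨x, hx, _, hp, rfl⟩ := Submodule.mem_sup.1 hu
    obtain ⟨a, rfl⟩ := Submodule.mem_span_singleton.1 hp
    obtain ⟨y, hy, _, hp', rfl⟩ := Submodule.mem_sup.1 hv
    obtain ⟨b, rfl⟩ := Submodule.mem_span_singleton.1 hp'
    have hxy := cpair_eq_zero_iff.1 (hiso x hx y hy)
    rw [cpair_eq_zero_iff]
    simp only [Prod.fst_add, Prod.snd_add, Prod.smul_fst, Prod.smul_snd, LinearMap.add_apply,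
      LinearMap.smul_apply, map_add, map_smul, smul_eq_mul]
    linear_combination hxy + b * horth x hx + a * horth y hy + 2 * a * b * hnull

/-- A maximal isotropic subspace contains its orthogonal complement. -/
theorem mem_of_orthogonal {T : Type*} [AddCommGroup T] [Module ℝ T]
    {L : Submodule ℝ (T × Module.Dual ℝ T)} (hiso : IsIsotropic L)
    (hmax : ∀ L' : Submodule ℝ (T × Module.Dual ℝ T), IsIsotropic L' → L ≤ L' → L' = L)
    {p : T × Module.Dual ℝ T} (horth : ∀ q ∈ L, q.2 p.1 + p.2 q.1 = 0) : p ∈ L := by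
  have hvert : ∀ α : Module.Dual ℝ T, (∀ q ∈ L, α q.1 = 0) → ((0 : T), α) ∈ L :=
    fun α hα => mem_of_orthogonal_of_null hiso hmax (by simp) (by simpa using hα)
  have hfst : p.1 ∈ L.map (LinearMap.fst ℝ T (Module.Dual ℝ T)) := by
    rw [← Subspace.forall_mem_dualAnnihilator_apply_eq_zero_iff]
    intro α hα
    rw [Submodule.mem_dualAnnihilator] at hα
    simpa using horth _ (hvert α fun q hq => hα _ (Submodule.mem_map_of_mem hq))
  obtain ⟨r, hr, hrp⟩ := hfst
  rw [LinearMap.fst_apply] at hrp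
  have hdiff : ((0 : T), p.2 - r.2) ∈ L := by
    refine hvert _ fun q hq => ?_
    have hrq := cpair_eq_zero_iff.1 (hiso r hr q hq)
    rw [hrp] at hrq
    rw [LinearMap.sub_apply]
    linear_combination horth q hq - hrq
  convert L.add_mem hr hdiff using 1
  ext <;> simp [hrp]

/-- A functional vanishing on the kernel of `f : V → W*` is evaluation of `f` at a vector of `W`. -/
theorem exists_forall_apply_eq_of_ker_le {K V W : Type*} [Field K] [AddCommGroup V] [Module K V]
    [AddCommGroup W] [Module K W] [FiniteDimensional K W] (f : V →ₗ[K] Module.Dual K W)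
    (φ : Module.Dual K V) (h : ∀ v, f v = 0 → φ v = 0) : ∃ w : W, ∀ v, f v w = φ v := by
  have hφ : φ ∈ LinearMap.range f.dualMap := by
    rw [LinearMap.range_dualMap_eq_dualAnnihilator_ker, Submodule.mem_dualAnnihilator]
    exact h
  obtain ⟨ψ, rfl⟩ := hφ
  obtain ⟨w, rfl⟩ := (Module.evalEquiv K W).surjective ψ
  exact ⟨w, fun v => by simp⟩

/-- For maximal isotropic `L`, the codistribution `K*` is the annihilator of `H(L, F)`. -/
theorem dualAnnihilator_couplingH {T : Type*} [AddCommGroup T] [Module ℝ T]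
    [FiniteDimensional ℝ T] (F : Submodule ℝ T) {L : Submodule ℝ (T × Module.Dual ℝ T)}
    (hiso : IsIsotropic L)
    (hmax : ∀ L' : Submodule ℝ (T × Module.Dual ℝ T), IsIsotropic L' → L ≤ L' → L' = L) :
    (couplingH L F).dualAnnihilator = couplingK L F := by
  ext θ
  rw [mem_couplingK, Submodule.mem_dualAnnihilator]
  constructor
  · intro hθ
    let restrict : L →ₗ[ℝ] Module.Dual ℝ F :=
      F.dualRestrict ∘ₗ LinearMap.snd ℝ T (Module.Dual ℝ T) ∘ₗ L.subtype
    let negEval : Module.Dual ℝ L := -(θ ∘ₗ LinearMap.fst ℝ T (Module.Dual ℝ T) ∘ₗ L.subtype)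
    have hker : ∀ q, restrict q = 0 → negEval q = 0 := by
      intro q hq
      have hq2 : (q : T × Module.Dual ℝ T).2 ∈ F.dualAnnihilator := by
        rw [← Submodule.dualRestrict_ker_eq_dualAnnihilator]
        exact hq
      simpa [negEval] using hθ _ (mem_couplingH.2 ⟨_, hq2, q.2⟩)
    obtain ⟨Y, hY⟩ :=
      exists_forall_apply_eq_of_ker_le (K := ℝ) (V := L) (W := F) restrict negEval hker
    refine ⟨Y, Y.2, mem_of_orthogonal hiso hmax fun q hq => ?_⟩
    have hqY : q.2 Y = -θ q.1 := hY ⟨q, hq⟩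
    exact add_eq_zero_iff_eq_neg.2 hqY
  · rintro ⟨Y, hY, hYθ⟩ Z hZ
    obtain ⟨α, hα, hZα⟩ := mem_couplingH.1 hZ
    have hpair := cpair_eq_zero_iff.1 (hiso _ hZα _ hYθ)
    simpa [(Submodule.mem_dualAnnihilator α).1 hα Y hY] using hpair

/-- Complementary subspaces correspond to complementary annihilators. -/
theorem isCompl_dualAnnihilator_iff {K V : Type*} [Field K] [AddCommGroup V] [Module K V]
    [FiniteDimensional K V] {U W : Submodule K V} :
    IsCompl U.dualAnnihilator W.dualAnnihilator ↔ IsCompl U W := by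
  rw [(Subspace.orderIsoFiniteDimensional (K := K) (V := V)).isCompl_iff]
  exact isCompl_toDual_iff.symm

/-- A maximal isotropic `L ⊆ T × T*` is `F`-coupling, i.e.
`T = H(L, F) ⊕ F`, iff `T* = ann F ⊕ K*` where `K* = {θ : ∃ Y ∈ F, (Y, θ) ∈ L}`. -/
theorem stmt16 {T : Type*} [AddCommGroup T] [Module ℝ T] [FiniteDimensional ℝ T]
    (F : Submodule ℝ T)
    (L : Submodule ℝ (T × Module.Dual ℝ T))
    (hiso : IsIsotropic L)
    (hmax : ∀ L' : Submodule ℝ (T × Module.Dual ℝ T), IsIsotropic L' → L ≤ L' → L' = L) :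
    IsCompl (couplingH L F) F ↔ IsCompl F.dualAnnihilator (couplingK L F) := by
  rw [← dualAnnihilator_couplingH F hiso hmax, isCompl_comm (x := F.dualAnnihilator),
    isCompl_dualAnnihilator_iff]
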